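/- Let X be a geodesic metric space, N a Morse gauge, Y ⊆ X an N-stable subset, and y ∈ Y. Then Y ⊆ X^(N)_y; every sequence in Y converging at infinity (with respect to Gromov products based at y) also converges at infinity as a sequence in X^(N)_y, and this induces a well-defined injective map ∂Y → ∂X^(N)_y between sequential boundaries which, for any visual metric on ∂Y and any visual metric on ∂X^(N)_y, is a quasi-symmetry onto its image. -/

import Mathlib

open Set Filter

section Defs

variable {X : Type*} [MetricSpace X]

/-- A geodesic segment of length `L`, parametrized by arc length on `[0, L]`. -/
def IsGeodesicSeg (γ : ℝ → X) (L : ℝ) : Prop :=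
  0 ≤ L ∧ ∀ s ∈ Icc (0:ℝ) L, ∀ t ∈ Icc (0:ℝ) L, dist (γ s) (γ t) = |s - t|

/-- A geodesic from `x` to `y`, parametrized by arc length on `[0, dist x y]`. -/
def IsGeodesicFromTo (γ : ℝ → X) (x y : X) : Prop :=
  IsGeodesicSeg γ (dist x y) ∧ γ 0 = x ∧ γ (dist x y) = y

/-- A geodesic ray, parametrized by arc length on `[0, ∞)`. -/
def IsGeodesicRay (ℓ : ℝ → X) : Prop :=
  ∀ s ∈ Ici (0:ℝ), ∀ t ∈ Ici (0:ℝ), dist (ℓ s) (ℓ t) = |s - t|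

/-- A geodesic metric space: any two points are joined by a geodesic. -/
def GeodesicSpace (X : Type*) [MetricSpace X] : Prop :=
  ∀ x y : X, ∃ γ : ℝ → X, IsGeodesicFromTo γ x y

/-- A `(K, C)`-quasi-geodesic defined on the interval `I ⊆ ℝ`. -/
def IsQuasiGeodesicOn (K C : ℝ) (I : Set ℝ) (σ : ℝ → X) : Prop :=
  ∀ s ∈ I, ∀ t ∈ I,
    |s - t| / K - C ≤ dist (σ s) (σ t) ∧ dist (σ s) (σ t) ≤ K * |s - t| + C

/-- A Morse gauge: a nonnegative real `N K C` for every `K ≥ 1`, `C ≥ 0`. -/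
def IsMorseGauge (N : ℝ → ℝ → ℝ) : Prop :=
  ∀ K C : ℝ, 1 ≤ K → 0 ≤ C → 0 ≤ N K C

/-- A subset `G ⊆ X` is `N`-Morse if for all `K ≥ 1`, `C ≥ 0`, every
`(K,C)`-quasi-geodesic with endpoints on `G` is contained in the closed
`N K C`-neighbourhood of `G`. -/
def IsMorseSet (N : ℝ → ℝ → ℝ) (G : Set X) : Prop :=
  ∀ K C : ℝ, 1 ≤ K → 0 ≤ C → ∀ a b : ℝ, a ≤ b → ∀ σ : ℝ → X,
    IsQuasiGeodesicOn K C (Icc a b) σ → σ a ∈ G → σ b ∈ G →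
    ∀ s ∈ Icc a b, ∃ g ∈ G, dist (σ s) g ≤ N K C

/-- An `N`-Morse geodesic from `x` to `y`. -/
def IsMorseGeodesicFromTo (N : ℝ → ℝ → ℝ) (γ : ℝ → X) (x y : X) : Prop :=
  IsGeodesicFromTo γ x y ∧ IsMorseSet N (γ '' Icc 0 (dist x y))

/-- An `N`-Morse geodesic ray. -/
def IsMorseRay (N : ℝ → ℝ → ℝ) (ℓ : ℝ → X) : Prop :=
  IsGeodesicRay ℓ ∧ IsMorseSet N (ℓ '' Ici 0)

/-- The stratum `X^(N)_e`: points joined to `e` by an `N`-Morse geodesic. -/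
def morseStratum (N : ℝ → ℝ → ℝ) (e : X) : Set X :=
  {y | ∃ γ : ℝ → X, IsMorseGeodesicFromTo N γ e y}

/-- The Gromov product `(x·y)_w`. -/
noncomputable def gprod (w x y : X) : ℝ := (dist w x + dist w y - dist x y) / 2

/-- A `B`-quasi-convex subset: geodesics with endpoints in `Y` stay in the
closed `B`-neighbourhood of `Y`. -/
def IsQuasiConvex (B : ℝ) (Y : Set X) : Prop :=
  ∀ x ∈ Y, ∀ y ∈ Y, ∀ γ : ℝ → X, IsGeodesicFromTo γ x y →
    ∀ s ∈ Icc (0:ℝ) (dist x y), ∃ g ∈ Y, dist (γ s) g ≤ B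

/-- An `N`-stable subset: quasi-convex, and any two of its points are joined
by an `N`-Morse geodesic of `X`. -/
def IsStableSubset (N : ℝ → ℝ → ℝ) (Y : Set X) : Prop :=
  (∃ B : ℝ, 0 ≤ B ∧ IsQuasiConvex B Y) ∧
    ∀ x ∈ Y, ∀ y ∈ Y, ∃ γ : ℝ → X, IsMorseGeodesicFromTo N γ x y

variable {Y : Type*} [MetricSpace Y]

/-- A `(K,C)`-quasi-isometric embedding. -/
def IsQIEmbedding (K C : ℝ) (q : X → Y) : Prop :=
  ∀ x x' : X,
    dist x x' / K - C ≤ dist (q x) (q x') ∧ dist (q x) (q x') ≤ K * dist x x' + C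

/-- A `(K,C)`-quasi-isometry. -/
def IsQuasiIsometry (K C : ℝ) (q : X → Y) : Prop :=
  IsQIEmbedding K C q ∧ ∀ y : Y, ∃ x : X, dist y (q x) ≤ C

end Defs

section Boundary

variable {X : Type*} [MetricSpace X]

/-- A sequence converges at infinity with respect to the basepoint `e`. -/
def ConvAtInf (e : X) (f : ℕ → X) : Prop :=
  Tendsto (fun p : ℕ × ℕ => gprod e (f p.1) (f p.2)) atTop atTop

/-- Two sequences converging at infinity are equivalent. -/
def EquivAtInf (e : X) (f g : ℕ → X) : Prop :=
  Tendsto (fun p : ℕ × ℕ => gprod e (f p.1) (g p.2)) atTop atTop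

/-- Sequences in `S` converging at infinity. -/
abbrev BSeq (S : Set X) (e : X) : Type _ :=
  {f : ℕ → X // (∀ n, f n ∈ S) ∧ ConvAtInf e f}

/-- The sequential boundary of `S ⊆ X` with basepoint `e`: sequences in `S`
converging at infinity, up to equivalence. -/
def SeqBoundary (S : Set X) (e : X) : Type _ :=
  Quot (fun f g : BSeq S e => EquivAtInf e f.1 g.1)

/-- The boundary point represented by a convergent sequence. -/
def SeqBoundary.mk {S : Set X} {e : X} (f : BSeq S e) : SeqBoundary S e :=
  Quot.mk _ f

/-- The liminf of Gromov products of two sequences, valued in `EReal`. -/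
noncomputable def seqGP (e : X) (f g : ℕ → X) : EReal :=
  Filter.liminf (fun p : ℕ × ℕ => ((gprod e (f p.1) (g p.2) : ℝ) : EReal)) atTop

/-- The Gromov product of two boundary points: the supremum over representing
sequences of the liminf of Gromov products. -/
noncomputable def bGP (S : Set X) (e : X) (ξ η : SeqBoundary S e) : EReal :=
  sSup {r : EReal | ∃ f g : BSeq S e,
    SeqBoundary.mk f = ξ ∧ SeqBoundary.mk g = η ∧ r = seqGP e f.1 g.1}

open Classical in
/-- `exp (−ε·r)` for an extended real `r`, with value `0` at `r = ⊤`. -/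
noncomputable def visGauge (ε : ℝ) (r : EReal) : ℝ :=
  if r = ⊤ then 0 else Real.exp (-ε * r.toReal)

/-- `d` is a visual metric on the sequential boundary of `S`:
a metric comparable to `exp(−ε·(Gromov product))` for some parameter `ε > 0`. -/
def IsVisualMetric (S : Set X) (e : X)
    (d : SeqBoundary S e → SeqBoundary S e → ℝ) : Prop :=
  (∀ ξ η, 0 ≤ d ξ η) ∧ (∀ ξ η, d ξ η = d η ξ) ∧
  (∀ ξ η ζ, d ξ ζ ≤ d ξ η + d η ζ) ∧ (∀ ξ η, d ξ η = 0 ↔ ξ = η) ∧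
  ∃ ε : ℝ, 0 < ε ∧ ∃ k₁ : ℝ, 0 < k₁ ∧ ∃ k₂ : ℝ, 0 < k₂ ∧
    ∀ ξ η, k₁ * visGauge ε (bGP S e ξ η) ≤ d ξ η ∧
      d ξ η ≤ k₂ * visGauge ε (bGP S e ξ η)

/-- `η` is (the restriction of) a self-homeomorphism of `[0,∞)`. -/
def IsHomeoIci (η : ℝ → ℝ) : Prop :=
  ContinuousOn η (Ici 0) ∧ StrictMonoOn η (Ici 0) ∧ η 0 = 0 ∧
    Tendsto η atTop atTop ∧ ∀ t ∈ Ici (0:ℝ), 0 ≤ η t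

/-- `F` is a quasi-symmetry onto its image, for the "distances" `dA`, `dB`. -/
def IsQuasiSymmetryOnto {A B : Type*} (dA : A → A → ℝ) (dB : B → B → ℝ)
    (F : A → B) : Prop :=
  Function.Injective F ∧ ∃ η : ℝ → ℝ, IsHomeoIci η ∧
    ∀ x y z : A, x ≠ y → x ≠ z → y ≠ z →
      dB (F x) (F y) / dB (F x) (F z) ≤ η (dA x y / dA x z)

end Boundary

/-- `X` (with basepoint `x`) is stably subsumed by `Y` (with basepoint `y`):
every stratum of `X` quasi-isometrically embeds in some stratum of `Y`. -/
def StablySubsumed (X Y : Type*) [MetricSpace X] [MetricSpace Y]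
    (x : X) (y : Y) : Prop :=
  ∀ N : ℝ → ℝ → ℝ, IsMorseGauge N →
    ∃ N' : ℝ → ℝ → ℝ, IsMorseGauge N' ∧
      ∃ K C : ℝ, 1 ≤ K ∧ 0 ≤ C ∧ ∃ f : X → Y,
        (∀ a ∈ morseStratum N x, f a ∈ morseStratum N' y) ∧
        ∀ a ∈ morseStratum N x, ∀ b ∈ morseStratum N x,
          dist a b / K - C ≤ dist (f a) (f b) ∧ dist (f a) (f b) ≤ K * dist a b + C

/-- Durham–Taylor stability of `f : Y → X`. -/
def DTStable {Y X : Type*} [MetricSpace Y] [MetricSpace X] (f : Y → X) : Prop :=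
  ∀ K C : ℝ, 1 ≤ K → 0 ≤ C → ∃ R : ℝ, 0 ≤ R ∧
    ∀ a₁ b₁ a₂ b₂ : ℝ, a₁ ≤ b₁ → a₂ ≤ b₂ → ∀ σ₁ σ₂ : ℝ → X,
      IsQuasiGeodesicOn K C (Icc a₁ b₁) σ₁ → IsQuasiGeodesicOn K C (Icc a₂ b₂) σ₂ →
      σ₁ a₁ = σ₂ a₂ → σ₁ b₁ = σ₂ b₂ →
      σ₁ a₁ ∈ Set.range f → σ₁ b₁ ∈ Set.range f →
      (∀ s ∈ Icc a₁ b₁, ∃ t ∈ Icc a₂ b₂, dist (σ₁ s) (σ₂ t) ≤ R) ∧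
      (∀ t ∈ Icc a₂ b₂, ∃ s ∈ Icc a₁ b₁, dist (σ₁ s) (σ₂ t) ≤ R)

section Helpers

variable {X : Type*} [MetricSpace X]

/-- Concatenating a geodesic `[e,q]` with a geodesic starting at `q` all of whose points are
at least as far from `e` as `q` gives a `(3,0)`-quasi-geodesic. -/
lemma concat_quasi (p1 p2 : ℝ → X) (L M : ℝ) (h1 : IsGeodesicSeg p1 L)
    (h2 : IsGeodesicSeg p2 M) (hj : p1 L = p2 0)
    (hmin : ∀ s ∈ Icc (0:ℝ) M, L ≤ dist (p1 0) (p2 s)) :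
    IsQuasiGeodesicOn 3 0 (Icc 0 (L + M)) (fun s => if s ≤ L then p1 s else p2 (s - L)) := by
  have key : ∀ s ∈ Icc (0:ℝ) L, ∀ t ∈ Icc (0:ℝ) M,
      (L - s + t) / 3 ≤ dist (p1 s) (p2 t) ∧ dist (p1 s) (p2 t) ≤ 3 * (L - s + t) := by
    intro s hs t ht
    have hL := h1.1
    have hM := h2.1
    have a1 := h1.2 0 ⟨le_rfl, hL⟩ s hs
    have a2 := h1.2 s hs L ⟨hL, le_rfl⟩
    have a3 := h2.2 0 ⟨le_rfl, hM⟩ t ht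
    rw [zero_sub, abs_neg, abs_of_nonneg hs.1] at a1
    rw [abs_sub_comm, abs_of_nonneg (by linarith [hs.2])] at a2
    rw [zero_sub, abs_neg, abs_of_nonneg ht.1] at a3
    rw [hj] at a2
    have b1 := hmin t ht
    have b2 := dist_triangle (p1 0) (p1 s) (p2 t)
    have b3 := dist_triangle (p1 s) (p2 0) (p2 t)
    have b4 := dist_triangle_left (p2 0) (p2 t) (p1 s)
    have := hs.1
    have := hs.2
    have := ht.1
    constructor <;> linarith
  intro s hs t ht
  by_cases c1 : s ≤ L <;> by_cases c2 : t ≤ L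
  · simp only [c1, c2, if_true]
    rw [h1.2 s ⟨hs.1, c1⟩ t ⟨ht.1, c2⟩]
    have := abs_nonneg (s - t)
    constructor <;> linarith
  · simp only [c1, c2, if_true, if_false]
    push Not at c2
    have := key s ⟨hs.1, c1⟩ (t - L) ⟨by linarith, by linarith [ht.2]⟩
    rw [abs_sub_comm, abs_of_nonneg (by linarith : 0 ≤ t - s)]
    constructor <;> linarith [this.1, this.2]
  · simp only [c1, c2, if_true, if_false]
    push Not at c1
    have := key t ⟨ht.1, c2⟩ (s - L) ⟨by linarith, by linarith [hs.2]⟩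
    rw [abs_of_nonneg (by linarith : 0 ≤ s - t), dist_comm]
    constructor <;> linarith [this.1, this.2]
  · simp only [c1, c2, if_false]
    push Not at c1 c2
    rw [h2.2 (s - L) ⟨by linarith, by linarith [hs.2]⟩ (t - L) ⟨by linarith, by linarith [ht.2]⟩]
    have e : s - L - (t - L) = s - t := by ring
    rw [e]
    have := abs_nonneg (s - t)
    constructor <;> linarith

/-- Points of `[e,q]` are close to the Morse geodesic `α`, at matching parameters, and passing
through `q` is almost a shortcut-free route from `e` to `x`. -/
lemma near_morse (N : ℝ → ℝ → ℝ) (p1 p2 α : ℝ → X) (e x : X) (L M : ℝ)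
    (h1 : IsGeodesicSeg p1 L)
    (h2 : IsGeodesicSeg p2 M) (hj : p1 L = p2 0)
    (hmin : ∀ s ∈ Icc (0:ℝ) M, L ≤ dist (p1 0) (p2 s))
    (he : p1 0 = e) (hx : p2 M = x) (hα : IsMorseGeodesicFromTo N α e x) :
    ∀ t ∈ Icc (0:ℝ) L, t ≤ dist e x → dist (p1 t) (α t) ≤ 2 * N 3 0 := by
  obtain ⟨⟨hg, hα0, hα1⟩, hm⟩ := hα
  have hL := h1.1
  have hM := h2.1
  intro t ht htx
  have := hm 3 0 (by norm_num) le_rfl 0 (L + M) (by linarith) _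
    (concat_quasi p1 p2 L M h1 h2 hj hmin)
    ⟨0, ⟨le_rfl, dist_nonneg⟩, by simp [hL, he, hα0]⟩
    ⟨dist e x, ⟨dist_nonneg, le_rfl⟩, by
      by_cases hM0 : M ≤ 0
      · have : M = 0 := le_antisymm hM0 hM
        subst this
        simp [hα1, hj, hx]
      · simp [hM0, hα1, hx]⟩ t ⟨ht.1, by linarith [ht.2]⟩
  obtain ⟨g, ⟨s, hs, rfl⟩, hd⟩ := this
  simp only [ht.2, if_true] at hd
  have a1 := h1.2 0 ⟨le_rfl, hL⟩ t ht
  have a2 := hg.2 0 ⟨le_rfl, dist_nonneg⟩ s hs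
  have a3 := hg.2 s hs t ⟨ht.1, htx⟩
  rw [zero_sub, abs_neg, abs_of_nonneg ht.1, he] at a1
  rw [zero_sub, abs_neg, abs_of_nonneg hs.1, hα0] at a2
  have b1 := dist_triangle e (p1 t) (α s)
  have b2 := dist_triangle_right e (p1 t) (α s)
  have b3 : |s - t| ≤ N 3 0 := abs_le.2 ⟨by linarith, by linarith⟩
  have := dist_triangle (p1 t) (α s) (α t)
  linarith

lemma gprod_le_left (e x y : X) : gprod e x y ≤ dist e x := by
  have := dist_triangle e x y
  unfold gprod; linarith

lemma gprod_comm (e x y : X) : gprod e x y = gprod e y x := by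
  unfold gprod; rw [dist_comm x y]; ring

lemma gprod_nonneg (e x y : X) : 0 ≤ gprod e x y := by
  have := dist_triangle_left x y e
  unfold gprod; linarith

/-- Two Morse geodesics from `e` fellow-travel up to the Gromov product. -/
lemma fellow (hX : GeodesicSpace X) (N : ℝ → ℝ → ℝ) (α β : ℝ → X) (e x y : X)
    (hα : IsMorseGeodesicFromTo N α e x) (hβ : IsMorseGeodesicFromTo N β e y)
    (t : ℝ) (ht : 0 ≤ t) (htg : t ≤ gprod e x y) :
    dist (α t) (β t) ≤ 4 * N 3 0 := by
  obtain ⟨γ, hγ, hγ0, hγ1⟩ := hX x y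
  have hcont : ContinuousOn γ (Icc 0 (dist x y)) := by
    have : LipschitzOnWith 1 γ (Icc 0 (dist x y)) := by
      apply LipschitzOnWith.of_dist_le_mul
      intro s hs t ht
      rw [hγ.2 s hs t ht]; simp [Real.dist_eq]
    exact this.continuousOn
  obtain ⟨t0, ht0, hmin⟩ := isCompact_Icc.exists_isMinOn (nonempty_Icc.2 hγ.1)
    ((continuous_const.dist continuous_id).comp_continuousOn hcont : ContinuousOn (fun s => dist e (γ s)) _)
  have hmin' : ∀ s ∈ Icc 0 (dist x y), dist e (γ t0) ≤ dist e (γ s) := fun s hs => hmin hs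
  obtain ⟨p, hp, hp0, hp1⟩ := hX e (γ t0)
  have htq : t ≤ dist e (γ t0) := by
    have a1 := hγ.2 0 ⟨le_rfl, dist_nonneg⟩ t0 ht0
    have a2 := hγ.2 t0 ht0 (dist x y) ⟨dist_nonneg, le_rfl⟩
    rw [zero_sub, abs_neg, abs_of_nonneg ht0.1, hγ0] at a1
    rw [abs_sub_comm, abs_of_nonneg (by linarith [ht0.2]), hγ1] at a2
    have b1 := dist_triangle e (γ t0) x
    have b2 := dist_triangle e (γ t0) y
    rw [dist_comm (γ t0) x] at b1
    unfold gprod at htg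
    linarith
  have hA := near_morse N p (fun s => γ (t0 - s)) α e x (dist e (γ t0)) t0 hp
    ⟨ht0.1, fun s hs t ht => by
      rw [hγ.2 _ ⟨by linarith [hs.2], by linarith [hs.1, ht0.2]⟩ _
        ⟨by linarith [ht.2], by linarith [ht.1, ht0.2]⟩, abs_sub_comm]
      congr 1; ring⟩ (by simp [hp1])
    (fun s hs => by
      rw [hp0]; exact hmin' _ ⟨by linarith [hs.2], by linarith [hs.1, ht0.2]⟩)
    hp0 (by simp [hγ0]) hα t ⟨ht, htq⟩ (htg.trans (gprod_le_left _ _ _))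
  have hB := near_morse N p (fun s => γ (t0 + s)) β e y (dist e (γ t0)) (dist x y - t0) hp
    ⟨by linarith [ht0.2], fun s hs t ht => by
      rw [hγ.2 _ ⟨by linarith [hs.1, ht0.1], by linarith [hs.2]⟩ _
        ⟨by linarith [ht.1, ht0.1], by linarith [ht.2]⟩]
      congr 1; ring⟩ (by simp [hp1])
    (fun s hs => by
      rw [hp0]; exact hmin' _ ⟨by linarith [hs.1, ht0.1], by linarith [hs.2]⟩)
    hp0 (by simp [hγ1]) hβ t ⟨ht, htq⟩
    (htg.trans (by rw [gprod_comm]; exact gprod_le_left _ _ _))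
  have := dist_triangle_left (α t) (β t) (p t)
  linarith

/-- The strata are hyperbolic in the four-point sense at the basepoint. -/
lemma stratum_hyp (hX : GeodesicSpace X) (N : ℝ → ℝ → ℝ) (e x y z : X)
    (hx : x ∈ morseStratum N e) (hy : y ∈ morseStratum N e) (hz : z ∈ morseStratum N e) :
    min (gprod e x y) (gprod e y z) - 4 * N 3 0 ≤ gprod e x z := by
  obtain ⟨α, hα⟩ := hx
  obtain ⟨β, hβ⟩ := hy
  obtain ⟨γ, hγ⟩ := hz
  set t := min (gprod e x y) (gprod e y z) with htdef
  have ht : 0 ≤ t := le_min (gprod_nonneg _ _ _) (gprod_nonneg _ _ _)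
  have h1 := fellow hX N α β e x y hα hβ t ht (min_le_left _ _)
  have h2 := fellow hX N β γ e y z hβ hγ t ht (min_le_right _ _)
  have tx : t ≤ dist e x := (min_le_left _ _).trans (gprod_le_left _ _ _)
  have tz : t ≤ dist e z := (min_le_right _ _).trans
    (by rw [gprod_comm]; exact gprod_le_left _ _ _)
  have a1 := hα.1.1.2 t ⟨ht, tx⟩ _ ⟨dist_nonneg, le_rfl⟩
  have a2 := hγ.1.1.2 t ⟨ht, tz⟩ _ ⟨dist_nonneg, le_rfl⟩
  rw [hα.1.2.2, abs_sub_comm, abs_of_nonneg (by linarith)] at a1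
  rw [hγ.1.2.2, abs_sub_comm, abs_of_nonneg (by linarith)] at a2
  have b1 := dist_triangle (α t) (β t) (γ t)
  have b2 := dist_triangle4 x (α t) (γ t) z
  rw [dist_comm x (α t)] at b2
  unfold gprod
  linarith

lemma equiv_iff (e : X) (f g : ℕ → X) :
    EquivAtInf e f g ↔ ∀ M : ℝ, ∃ n, ∀ i ≥ n, ∀ j ≥ n, M ≤ gprod e (f i) (g j) := by
  unfold EquivAtInf
  rw [tendsto_atTop]
  refine forall_congr' fun M => ?_
  rw [eventually_atTop]
  constructor
  · rintro ⟨⟨a, b⟩, h⟩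
    exact ⟨max a b, fun i hi j hj => h (i, j)
      ⟨(le_max_left _ _).trans hi, (le_max_right _ _).trans hj⟩⟩
  · rintro ⟨n, h⟩
    exact ⟨(n, n), fun p hp => h _ hp.1 _ hp.2⟩

/-- In a stratum, equality of boundary points is equivalence of sequences. -/
lemma equiv_of_mk_eq (hX : GeodesicSpace X) (N : ℝ → ℝ → ℝ) (e : X)
    (f g : BSeq (morseStratum N e) e) (h : SeqBoundary.mk f = SeqBoundary.mk g) :
    EquivAtInf e f.1 g.1 := by
  have h' := Quot.eqvGen_exact h
  clear h
  induction h' with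
  | rel _ _ h => exact h
  | refl f => exact f.2.2
  | symm f g _ ih =>
    rw [equiv_iff] at ih ⊢
    intro M
    obtain ⟨n, hn⟩ := ih M
    exact ⟨n, fun i hi j hj => by rw [gprod_comm]; exact hn j hj i hi⟩
  | trans f g k _ _ ih1 ih2 =>
    rw [equiv_iff] at ih1 ih2 ⊢
    intro M
    obtain ⟨n, hn⟩ := ih1 (M + 4 * N 3 0)
    obtain ⟨m, hm⟩ := ih2 (M + 4 * N 3 0)
    refine ⟨max n m, fun i hi j hj => ?_⟩
    have h1 := hn i ((le_max_left _ _).trans hi) (max n m) (le_max_left _ _)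
    have h2 := hm (max n m) (le_max_right _ _) j ((le_max_right _ _).trans hj)
    have := stratum_hyp hX N e _ _ _ (f.2.1 i) (g.2.1 (max n m)) (k.2.1 j)
    have := le_min h1 h2
    linarith

lemma seqGP_lower (hX : GeodesicSpace X) (N : ℝ → ℝ → ℝ) (hN : 0 ≤ N 3 0) (e : X)
    (f g f' g' : BSeq (morseStratum N e) e)
    (hf : EquivAtInf e f'.1 f.1) (hg : EquivAtInf e g.1 g'.1) (c : ℝ)
    (hc : (c : EReal) < seqGP e f.1 g.1) :
    ((c - 8 * N 3 0 : ℝ) : EReal) ≤ seqGP e f'.1 g'.1 := by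
  have hev := eventually_lt_of_lt_liminf hc
  rw [eventually_atTop] at hev
  obtain ⟨⟨a, b⟩, hab⟩ := hev
  rw [equiv_iff] at hf hg
  obtain ⟨n, hn⟩ := hf c
  obtain ⟨m, hm⟩ := hg c
  apply le_liminf_of_le
  · isBoundedDefault
  rw [eventually_atTop]
  refine ⟨(n, m), fun p hp => ?_⟩
  rw [EReal.coe_le_coe_iff]
  have h1 := hn p.1 hp.1 (max n a) (le_max_left _ _)
  have h2 := hm (max m b) (le_max_left _ _) p.2 hp.2
  have h3 := hab (max n a, max m b) ⟨le_max_right _ _, le_max_right _ _⟩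
  have h3 : c < gprod e (f.1 (max n a)) (g.1 (max m b)) := EReal.coe_lt_coe_iff.1 h3
  have k1 := stratum_hyp hX N e _ _ _ (f'.2.1 p.1) (f.2.1 (max n a)) (g.2.1 (max m b))
  have k2 := stratum_hyp hX N e _ _ _ (f'.2.1 p.1) (g.2.1 (max m b)) (g'.2.1 p.2)
  have l1 := le_min h1 h3.le
  have l2 : c - 4 * N 3 0 ≤ min (gprod e (f'.1 p.1) (g.1 (max m b)))
    (gprod e (g.1 (max m b)) (g'.1 p.2)) := le_min (by linarith) (by linarith)
  linarith

lemma bGP_nonneg (S : Set X) (e : X) (ξ η : SeqBoundary S e) : 0 ≤ bGP S e ξ η := by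
  obtain ⟨f, rfl⟩ := Quot.exists_rep ξ
  obtain ⟨g, rfl⟩ := Quot.exists_rep η
  refine le_trans ?_ (le_sSup ⟨f, g, rfl, rfl, rfl⟩)
  apply le_liminf_of_le
  · isBoundedDefault
  exact Eventually.of_forall fun p => by exact_mod_cast gprod_nonneg _ _ _

/-- The map of boundaries induced by an inclusion. -/
def inclBdry {S T : Set X} (h : S ⊆ T) (e : X) : SeqBoundary S e → SeqBoundary T e :=
  Quot.map (fun f : BSeq S e => (⟨f.1, fun n => h (f.2.1 n), f.2.2⟩ : BSeq T e))
    (fun _ _ h => h)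

lemma bGP_mono {S T : Set X} (h : S ⊆ T) (e : X) (ξ η : SeqBoundary S e) :
    bGP S e ξ η ≤ bGP T e (inclBdry h e ξ) (inclBdry h e η) := by
  apply sSup_le_sSup
  rintro r ⟨f, g, rfl, rfl, rfl⟩
  exact ⟨⟨f.1, fun n => h (f.2.1 n), f.2.2⟩, ⟨g.1, fun n => h (g.2.1 n), g.2.2⟩, rfl, rfl, rfl⟩

lemma bGP_upper (hX : GeodesicSpace X) (N : ℝ → ℝ → ℝ) (hN : 0 ≤ N 3 0) (e : X) {S : Set X}
    (h : S ⊆ morseStratum N e) (ξ η : SeqBoundary S e) (a : ℝ) (ha : bGP S e ξ η ≤ a) :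
    bGP _ e (inclBdry h e ξ) (inclBdry h e η) ≤ ((a + 8 * N 3 0 : ℝ) : EReal) := by
  obtain ⟨u, rfl⟩ := Quot.exists_rep ξ
  obtain ⟨v, rfl⟩ := Quot.exists_rep η
  apply sSup_le
  rintro r ⟨f, g, hf, hg, rfl⟩
  by_contra hlt
  push Not at hlt
  obtain ⟨c, hc1, hc2⟩ := EReal.lt_iff_exists_real_btwn.1 hlt
  have h1 := seqGP_lower hX N hN e f g ⟨u.1, fun n => h (u.2.1 n), u.2.2⟩
    ⟨v.1, fun n => h (v.2.1 n), v.2.2⟩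
    (equiv_of_mk_eq hX N e _ _ hf.symm) (equiv_of_mk_eq hX N e _ _ hg) c hc2
  have h2 : seqGP e u.1 v.1 ≤ bGP S e (Quot.mk _ u) (Quot.mk _ v) :=
    le_sSup ⟨u, v, rfl, rfl, rfl⟩
  have h3 := (h1.trans h2).trans ha
  rw [EReal.coe_le_coe_iff] at h3
  rw [EReal.coe_lt_coe_iff] at hc1
  linarith

lemma inclBdry_injective (hX : GeodesicSpace X) (N : ℝ → ℝ → ℝ) (e : X) {S : Set X}
    (h : S ⊆ morseStratum N e) : Function.Injective (inclBdry h e) := by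
  intro ξ η hξ
  obtain ⟨u, rfl⟩ := Quot.exists_rep ξ
  obtain ⟨v, rfl⟩ := Quot.exists_rep η
  exact Quot.sound (equiv_of_mk_eq hX N e ⟨u.1, fun n => h (u.2.1 n), u.2.2⟩
    ⟨v.1, fun n => h (v.2.1 n), v.2.2⟩ hξ)

lemma homeo_rpow (C p : ℝ) (hC : 0 < C) (hp : 0 < p) :
    IsHomeoIci (fun t => C * t ^ p) := by
  refine ⟨?_, ?_, ?_, ?_, ?_⟩
  · exact ((Real.continuous_rpow_const hp.le).const_mul C).continuousOn
  · intro s hs t _ hst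
    exact mul_lt_mul_of_pos_left (Real.rpow_lt_rpow hs hst hp) hC
  · simp [Real.zero_rpow hp.ne']
  · exact (tendsto_rpow_atTop hp).const_mul_atTop hC
  · intro t ht
    exact mul_nonneg hC.le (Real.rpow_nonneg ht p)

/-- For a visual metric, distinct points have finite product and the distance is comparable to
the exponential. -/
lemma visual_finite {S : Set X} {e : X} {d : SeqBoundary S e → SeqBoundary S e → ℝ} {ε k₁ k₂ : ℝ}
    (hd0 : ∀ ξ η, d ξ η = 0 ↔ ξ = η) (hd : ∀ ξ η, 0 ≤ d ξ η)
    (h : ∀ ξ η, k₁ * visGauge ε (bGP S e ξ η) ≤ d ξ η ∧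
      d ξ η ≤ k₂ * visGauge ε (bGP S e ξ η)) (ξ η : SeqBoundary S e) (hne : ξ ≠ η) :
    ∃ a : ℝ, bGP S e ξ η = a ∧ k₁ * Real.exp (-ε * a) ≤ d ξ η ∧
      d ξ η ≤ k₂ * Real.exp (-ε * a) := by
  have htop : bGP S e ξ η ≠ ⊤ := by
    intro ht
    have := (h ξ η).2
    simp only [ht, visGauge, if_true, mul_zero] at this
    exact hne ((hd0 ξ η).1 (le_antisymm this (hd ξ η)))
  have hbot : bGP S e ξ η ≠ ⊥ := by
    intro hb
    have := bGP_nonneg S e ξ η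
    rw [hb] at this
    simp at this
  refine ⟨(bGP S e ξ η).toReal, (EReal.coe_toReal htop hbot).symm, ?_⟩
  have := h ξ η
  simpa only [visGauge, htop, if_false] using this

end Helpers


/-- an `N`-stable subset `Y` with `y ∈ Y` satisfies
`Y ⊆ X^(N)_y`, and the inclusion induces an injective boundary map
`∂Y → ∂X^(N)_y` which is a quasi-symmetry onto its image for any
visual metrics. -/
theorem statement19 {X : Type*} [MetricSpace X] (hX : GeodesicSpace X)
    (N : ℝ → ℝ → ℝ) (hN : IsMorseGauge N)
    (Y : Set X) (hY : IsStableSubset N Y) (y : X) (hy : y ∈ Y) :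
    Y ⊆ morseStratum N y ∧
    (∀ f : ℕ → X, (∀ n, f n ∈ Y) → ConvAtInf y f →
      (∀ n, f n ∈ morseStratum N y) ∧ ConvAtInf y f) ∧
    ∃ ι : SeqBoundary Y y → SeqBoundary (morseStratum N y) y,
      (∀ (u : BSeq Y y) (v : BSeq (morseStratum N y) y),
          (∀ n, v.1 n = u.1 n) → ι (SeqBoundary.mk u) = SeqBoundary.mk v) ∧
      Function.Injective ι ∧
      ∀ d d', IsVisualMetric Y y d → IsVisualMetric (morseStratum N y) y d' →
        IsQuasiSymmetryOnto d d' ι := by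
  have hsub : Y ⊆ morseStratum N y := fun x hx => hY.2 y hy x hx
  have hN0 : 0 ≤ N 3 0 := hN 3 0 (by norm_num) le_rfl
  have hinj := inclBdry_injective hX N y hsub
  refine ⟨hsub, fun f hf hc => ⟨fun n => hsub (hf n), hc⟩, inclBdry hsub y, ?_, hinj, ?_⟩
  · intro u v huv
    have : v = ⟨u.1, fun n => hsub (u.2.1 n), u.2.2⟩ := Subtype.ext (funext huv)
    rw [this]
    rfl
  intro d d' hd hd'
  refine ⟨hinj, ?_⟩
  obtain ⟨hd1, -, -, hd4, ε, hε, k₁, hk₁, k₂, hk₂, hk⟩ := hd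
  obtain ⟨hd1', -, -, hd4', ε', hε', k₁', hk₁', k₂', hk₂', hk'⟩ := hd'
  refine ⟨_, homeo_rpow (k₂' / k₁' * Real.exp (ε' * (8 * N 3 0)) * (k₂ / k₁) ^ (ε' / ε)) (ε' / ε)
    (by positivity) (by positivity), ?_⟩
  intro ξ η ζ h1 h2 _
  obtain ⟨a, ha, la, ua⟩ := visual_finite hd4 hd1 hk ξ η h1
  obtain ⟨b, hb, lb, ub⟩ := visual_finite hd4 hd1 hk ξ ζ h2
  obtain ⟨a', ha', la', ua'⟩ := visual_finite hd4' hd1' hk' _ _ (hinj.ne h1)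
  obtain ⟨b', hb', lb', ub'⟩ := visual_finite hd4' hd1' hk' _ _ (hinj.ne h2)
  have haa : a ≤ a' := by
    have := bGP_mono hsub y ξ η
    rw [ha, ha'] at this
    exact_mod_cast this
  have hbb : b' ≤ b + 8 * N 3 0 := by
    have := bGP_upper hX N hN0 y hsub ξ ζ b hb.le
    rw [hb'] at this
    exact EReal.coe_le_coe_iff.1 this
  have step1 : d' (inclBdry hsub y ξ) (inclBdry hsub y η) /
      d' (inclBdry hsub y ξ) (inclBdry hsub y ζ) ≤
      k₂' / k₁' * Real.exp (ε' * (8 * N 3 0)) * Real.exp (-ε' * (a - b)) := by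
    have : d' (inclBdry hsub y ξ) (inclBdry hsub y η) /
        d' (inclBdry hsub y ξ) (inclBdry hsub y ζ) ≤
        (k₂' * Real.exp (-ε' * a')) / (k₁' * Real.exp (-ε' * b')) :=
      div_le_div₀ (by positivity) ua' (by positivity) lb'
    refine this.trans ?_
    rw [mul_div_mul_comm, ← Real.exp_sub, mul_assoc, ← Real.exp_add]
    refine mul_le_mul_of_nonneg_left (Real.exp_le_exp.2 ?_) (by positivity)
    nlinarith
  have step2 : Real.exp (-ε' * (a - b)) ≤ (k₂ / k₁) ^ (ε' / ε) * (d ξ η / d ξ ζ) ^ (ε' / ε) := by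
    have hpos : 0 ≤ d ξ η / d ξ ζ := div_nonneg (hd1 _ _) (hd1 _ _)
    rw [← Real.mul_rpow (by positivity) hpos]
    have e1 : Real.exp (-ε' * (a - b)) = (Real.exp (-ε * (a - b))) ^ (ε' / ε) := by
      rw [← Real.exp_mul]
      congr 1
      field_simp
    rw [e1]
    refine Real.rpow_le_rpow (Real.exp_pos _).le ?_ (by positivity)
    have hdz : 0 < d ξ ζ := lt_of_lt_of_le (by positivity) lb
    have : (k₁ * Real.exp (-ε * a)) / (k₂ * Real.exp (-ε * b)) ≤ d ξ η / d ξ ζ :=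
      div_le_div₀ (hd1 _ _) la hdz ub
    have e2 : Real.exp (-ε * (a - b)) =
        k₂ / k₁ * ((k₁ * Real.exp (-ε * a)) / (k₂ * Real.exp (-ε * b))) := by
      rw [mul_div_mul_comm, ← Real.exp_sub]
      have : -ε * a - -ε * b = -ε * (a - b) := by ring
      rw [this]
      field_simp
    rw [e2]
    exact mul_le_mul_of_nonneg_left this (by positivity)
  refine step1.trans ?_
  show _ ≤ k₂' / k₁' * Real.exp (ε' * (8 * N 3 0)) * (k₂ / k₁) ^ (ε' / ε) *
    (d ξ η / d ξ ζ) ^ (ε' / ε)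
  rw [mul_assoc _ ((k₂ / k₁) ^ (ε' / ε))]
  exact mul_le_mul_of_nonneg_left step2 (by positivity)
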